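/- arXiv:1610.07891 — 2 statements merged into one kernel-verified Lean document; each statement's English description precedes it below -/
import Mathlib

section
/- Fix a monomial ordering on the monomials of F_Q[X_1,…,X_m]. Let f ∈ F_Q[X_1,…,X_m] be a nonzero polynomial such that deg_{X_j}(f) ≤ T_j for every j (equivalently, every exponent tuple of a monomial of f lies in H_J), and let X^a = X_1^{a_1}⋯X_m^{a_m} be the leading monomial of f with respect to this ordering. Then the number of points P ∈ Z_J with f(P) ≠ 0 is at least δ_a = ∏_{j=1}^m (N_j − ε_j − a_j). -/
/-- On a finite set with more than `d` points there are weights that extract the coefficient of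
`X ^ d` from polynomials of degree at most `d`. -/
theorem exists_weights_sum_mul_pow {F : Type*} [Field F] (S : Finset F) {d : ℕ} (hd : d < S.card) :
    ∃ w : F → F, (∀ i < d, ∑ x ∈ S, w x * x ^ i = 0) ∧ ∑ x ∈ S, w x * x ^ d = 1 := by
  classical
  obtain ⟨U, hUS, hU⟩ := Finset.exists_subset_card_eq (Nat.succ_le_of_lt hd)
  have key : ∀ i ≤ d, ∑ x ∈ S, (if x ∈ U then (∏ y ∈ U.erase x, (x - y))⁻¹ else 0) * x ^ i =
      if d = i then 1 else 0 := by
    intro i hi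
    have h := Lagrange.coeff_eq_sum (s := U) (v := id) Function.injective_id.injOn
      (P := (Polynomial.X : Polynomial F) ^ i)
      (by rw [Polynomial.degree_X_pow, hU]; exact_mod_cast Nat.lt_succ_of_le hi)
    rw [hU, Nat.succ_sub_one, Polynomial.coeff_X_pow] at h
    rw [h, ← Finset.sum_subset hUS]
    · refine Finset.sum_congr rfl fun x hx => ?_
      simp [hx, div_eq_mul_inv, mul_comm]
    · intro x _ hx
      simp [hx]
  refine ⟨fun x => if x ∈ U then (∏ y ∈ U.erase x, (x - y))⁻¹ else 0,
    fun i hi => ?_, ?_⟩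
  · rw [key i hi.le, if_neg hi.ne']
  · rw [key d le_rfl, if_pos rfl]

/-- If the exponent `d` occurs in `h` and no other exponent of `h` dominates `d` componentwise,
then `h` does not vanish on a grid whose `j`-th side has more than `d j` points. -/
theorem MvPolynomial.exists_eval_ne_zero_of_minimal_exponent {ι F : Type*} [Fintype ι] [Field F]
    (S : ι → Finset F) (h : MvPolynomial ι F) (d : ι →₀ ℕ) (hdS : ∀ j, d j < (S j).card)
    (hd : d ∈ h.support) (hmin : ∀ b ∈ h.support, d ≤ b → b = d) :
    ∃ x : ι → F, (∀ j, x j ∈ S j) ∧ MvPolynomial.eval x h ≠ 0 := by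
  classical
  choose w hw0 hw1 using fun j => exists_weights_sum_mul_pow (S j) (hdS j)
  by_contra! hx
  refine MvPolynomial.mem_support_iff.mp hd ?_
  have hsum : ∑ x ∈ Fintype.piFinset S, (∏ j, w j (x j)) * MvPolynomial.eval x h =
      h.coeff d := by
    simp_rw [MvPolynomial.eval_eq', Finset.mul_sum]
    rw [Finset.sum_comm]
    have hterm : ∀ b, ∑ x ∈ Fintype.piFinset S,
        (∏ j, w j (x j)) * (h.coeff b * ∏ j, x j ^ b j) =
        h.coeff b * ∏ j, ∑ t ∈ S j, w j t * t ^ b j := by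
      intro b
      rw [Finset.prod_univ_sum, Finset.mul_sum]
      refine Finset.sum_congr rfl fun x _ => ?_
      rw [Finset.prod_mul_distrib]
      ring
    simp_rw [hterm]
    rw [Finset.sum_eq_single_of_mem d hd]
    · simp [hw1]
    · intro b hb hbd
      obtain ⟨j, hj⟩ : ∃ j, b j < d j := by
        by_contra! hle
        exact hbd (hmin b hb hle)
      rw [Finset.prod_eq_zero (Finset.mem_univ j) (hw0 j _ hj), mul_zero]
  rw [← hsum]
  refine Finset.sum_eq_zero fun x hxS => ?_
  rw [hx x (Fintype.mem_piFinset.mp hxS), mul_zero]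

/-- The footprint bound on a finite grid, for an arbitrary monomial ordering. -/
theorem MvPolynomial.prod_card_sub_le_card_eval_ne_zero {ι F : Type*} [Fintype ι] [Field F]
    [DecidableEq F] [DecidableEq ι] (S : ι → Finset F)
    (ord : (ι →₀ ℕ) → (ι →₀ ℕ) → Prop) [IsLinearOrder (ι →₀ ℕ) ord]
    (hadd : ∀ u v w : ι →₀ ℕ, ord u v → ord (u + w) (v + w)) (hzero : ∀ u : ι →₀ ℕ, ord 0 u)
    (f : MvPolynomial ι F) (a : ι →₀ ℕ) (ha : a ∈ f.support) (hlead : ∀ b ∈ f.support, ord b a) :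
    ∏ j, ((S j).card - a j) ≤
      ((Fintype.piFinset S).filter fun x => MvPolynomial.eval x f ≠ 0).card := by
  have hle : ∀ u v : ι →₀ ℕ, u ≤ v → ord u v := fun u v huv => by
    simpa [tsub_add_cancel_of_le huv] using hadd 0 (v - u) u (hzero _)
  set P := (Fintype.piFinset S).filter fun x => MvPolynomial.eval x f ≠ 0
  let B : Finset (ι →₀ ℕ) := (Fintype.piFinset fun j => Finset.range ((S j).card - a j)).map
    Finsupp.equivFunOnFinite.symm.toEmbedding
  have hB : ∀ u ∈ B, ∀ j, u j < (S j).card - a j := by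
    intro u hu j
    obtain ⟨v, hv, rfl⟩ := Finset.mem_map.mp hu
    simpa using Fintype.mem_piFinset.mp hv j
  have hBcard : B.card = ∏ j, ((S j).card - a j) := by simp [B]
  let V := MvPolynomial.restrictSupport F (B : Set (ι →₀ ℕ))
  let E : V →ₗ[F] (P → F) :=
    (LinearMap.pi fun x : P => (MvPolynomial.aeval (R := F) (x : ι → F)).toLinearMap) ∘ₗ V.subtype
  have hV : Module.finrank F V = B.card := by
    rw [Module.finrank_eq_card_basis (MvPolynomial.basisRestrictSupport F (B : Set (ι →₀ ℕ)))]
    simp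
  rw [← hBcard, ← hV, ← Fintype.card_coe P, ← Module.finrank_fintype_fun_eq_card F]
  refine LinearMap.finrank_le_finrank_of_injective (f := E) ?_
  rw [← LinearMap.ker_eq_bot, LinearMap.ker_eq_bot']
  rintro ⟨g, hgV⟩ hg
  by_contra hg0
  replace hg0 : g ≠ 0 := fun h => hg0 (by simp [h])
  have hgB : ∀ u ∈ g.support, u ∈ B := fun u hu =>
    (MvPolynomial.mem_restrictSupport_iff F).mp hgV hu
  obtain ⟨u, hu, hmax⟩ : ∃ u ∈ g.support, ∀ v ∈ g.support, ord v u := by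
    have : Nonempty g.support := (MvPolynomial.support_nonempty.mpr hg0).to_subtype
    have hdir : Directed ord (fun v : g.support => (v : ι →₀ ℕ)) := fun v v' =>
      (Std.Total.total (r := ord) (v : ι →₀ ℕ) v').elim
        (fun h => ⟨v', h, hle _ _ le_rfl⟩) fun h => ⟨v, hle _ _ le_rfl, h⟩
    obtain ⟨z, hz⟩ := hdir.finset_le Finset.univ
    exact ⟨z, z.2, fun v hv => hz ⟨v, hv⟩ (Finset.mem_univ _)⟩
  have hanti : ∀ b ∈ f.support, ∀ v ∈ g.support, a + u ≤ b + v → b = a ∧ v = u := by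
    intro b hb v hv h
    have h1 : ord (b + v) (a + v) := hadd _ _ _ (hlead b hb)
    have h2 : ord (a + v) (a + u) := by
      simpa only [add_comm a] using hadd _ _ a (hmax v hv)
    have h3 := hle _ _ h
    have h4 : a + v = a + u := antisymm_of ord h2 (trans_of ord h3 h1)
    have h5 : b + v = a + v := antisymm_of ord h1 (trans_of ord h2 h3)
    exact ⟨add_right_cancel h5, add_left_cancel h4⟩
  have hcoeff : a + u ∈ (f * g).support := by
    rw [MvPolynomial.mem_support_iff, MvPolynomial.coeff_mul,
      Finset.sum_eq_single_of_mem (a, u) (Finset.HasAntidiagonal.mem_antidiagonal.mpr rfl)]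
    · exact mul_ne_zero (MvPolynomial.mem_support_iff.mp ha) (MvPolynomial.mem_support_iff.mp hu)
    · rintro ⟨b, v⟩ hbv hne
      by_contra h
      obtain ⟨rfl, rfl⟩ := hanti b (MvPolynomial.mem_support_iff.mpr (left_ne_zero_of_mul h)) v
        (MvPolynomial.mem_support_iff.mpr (right_ne_zero_of_mul h))
        (Finset.HasAntidiagonal.mem_antidiagonal.mp hbv).ge
      exact hne rfl
  obtain ⟨x, hxS, hx⟩ := MvPolynomial.exists_eval_ne_zero_of_minimal_exponent S (f * g) (a + u)
    (fun j => by have := hB u (hgB u hu) j; rw [Finsupp.add_apply]; omega) hcoeff (by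
      intro c hc hac
      obtain ⟨b, hb, v, hv, rfl⟩ := Finset.mem_add.mp (MvPolynomial.support_mul f g hc)
      obtain ⟨rfl, rfl⟩ := hanti b hb v hv hac
      rfl)
  rw [map_mul] at hx
  have hxP : x ∈ P := Finset.mem_filter.mpr
    ⟨Fintype.mem_piFinset.mpr hxS, left_ne_zero_of_mul hx⟩
  have hgx := congrFun hg ⟨x, hxP⟩
  exact right_ne_zero_of_mul hx (by simpa [E, MvPolynomial.aeval_eq_eval] using hgx)

/-- A finite field contains `n` roots of `X ^ n - 1` when `n` divides the order of its
multiplicative group. -/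
theorem FiniteField.card_filter_pow_eq_one {F : Type*} [Field F] [Fintype F] [DecidableEq F]
    {n : ℕ} (hn : 0 < n) (hdvd : n ∣ Fintype.card F - 1) :
    (Finset.univ.filter fun x : F => x ^ n = 1).card = n := by
  obtain ⟨g, hg⟩ := IsCyclic.exists_ofOrder_eq_natCard (α := Fˣ)
  rw [Nat.card_eq_fintype_card, Fintype.card_units] at hg
  have hpos : 0 < Fintype.card F - 1 := hg ▸ orderOf_pos g
  have hprim : IsPrimitiveRoot (g : F) (Fintype.card F - 1) :=
    IsPrimitiveRoot.coe_units_iff.mpr (hg ▸ IsPrimitiveRoot.orderOf g)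
  obtain ⟨k, hk⟩ := hdvd
  have hζ := (hprim.pow hpos (hk.trans (mul_comm n k))).card_nthRootsFinset
  rw [← hζ]
  congr 1
  ext x
  simp [Polynomial.mem_nthRootsFinset hn, hζ]

/-- A finite field contains `n + 1` roots of `X ^ (n + 1) - X` when `n` divides the order of its
multiplicative group. -/
theorem FiniteField.card_filter_pow_succ_eq_self {F : Type*} [Field F] [Fintype F]
    [DecidableEq F] {n : ℕ} (hn : 0 < n) (hdvd : n ∣ Fintype.card F - 1) :
    (Finset.univ.filter fun x : F => x ^ (n + 1) = x).card = n + 1 := by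
  have h : (Finset.univ.filter fun x : F => x ^ (n + 1) = x) =
      insert 0 (Finset.univ.filter fun x : F => x ^ n = 1) := by
    ext x
    by_cases hx : x = 0
    · simp [hx]
    · simp [hx, pow_succ]
  rw [h, Finset.card_insert_of_notMem (by simp [hn.ne']),
    FiniteField.card_filter_pow_eq_one hn hdvd]


/-- Proposition 7 of the paper, footprint bound. If `f` is a nonzero
polynomial whose monomials have exponents in `H_J` and whose leading monomial (with
respect to a monomial ordering `ord`) is `X^a`, then `f` is nonzero at at least
`δ_a = ∏_j (N_j − ε_j − a_j)` points of `Z_J`. -/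
theorem footprint_bound_for_J_affine_varieties
    (p e m : ℕ) (hp : p.Prime) (he : 0 < e)
    (F : Type) [Field F] [Fintype F] [DecidableEq F]
    (hF : Fintype.card F = p ^ e)
    (N : Fin m → ℕ) (hN : ∀ j, 1 < N j)
    (hNdvd : ∀ j, (N j - 1) ∣ (Fintype.card F - 1))
    (J : Finset (Fin m))
    -- a monomial ordering: a translation-invariant linear order on exponents
    -- for which `0` is the least element
    (ord : (Fin m →₀ ℕ) → (Fin m →₀ ℕ) → Prop)
    (hord_lin : IsLinearOrder (Fin m →₀ ℕ) ord)
    (hord_add : ∀ u v w : Fin m →₀ ℕ, ord u v → ord (u + w) (v + w))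
    (hord_zero : ∀ u : Fin m →₀ ℕ, ord 0 u)
    (f : MvPolynomial (Fin m) F) (hf : f ≠ 0)
    (hdeg : ∀ b ∈ f.support, ∀ j, b j ≤ N j - 1 - (if j ∈ J then 1 else 0))
    (a : Fin m →₀ ℕ) (ha : a ∈ f.support)
    (hlead : ∀ b ∈ f.support, ord b a) :
    ∏ j, (N j - (if j ∈ J then 1 else 0) - a j) ≤
      (Finset.univ.filter (fun x : Fin m → F =>
        (∀ j, (j ∈ J → x j ^ (N j - 1) = 1) ∧ (j ∉ J → x j ^ (N j) = x j)) ∧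
        MvPolynomial.eval x f ≠ 0)).card := by
  let S : Fin m → Finset F := fun j => Finset.univ.filter fun x =>
    (j ∈ J → x ^ (N j - 1) = 1) ∧ (j ∉ J → x ^ N j = x)
  have hS : ∀ j, (S j).card = N j - (if j ∈ J then 1 else 0) := by
    intro j
    have hpos : 0 < N j - 1 := Nat.sub_pos_of_lt (hN j)
    by_cases hj : j ∈ J
    · simpa [S, hj] using FiniteField.card_filter_pow_eq_one hpos (hNdvd j)
    · have h := FiniteField.card_filter_pow_succ_eq_self hpos (hNdvd j)
      rw [Nat.sub_add_cancel (hN j).le] at h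
      simpa [S, hj] using h
  have h := MvPolynomial.prod_card_sub_le_card_eval_ne_zero S ord hord_add hord_zero f a ha hlead
  simp_rw [hS] at h
  refine h.trans (Finset.card_le_card fun x hx => ?_)
  rw [Finset.mem_filter, Fintype.mem_piFinset] at hx
  exact Finset.mem_filter.mpr
    ⟨Finset.mem_univ x, fun j => (Finset.mem_filter.mp (hx.1 j)).2, hx.2⟩
end

section
/- Assume that p divides N_j for every j ∉ J, and let t be a positive integer with t ≤ n_J. Then E(J,t) is exactly the Euclidean dual of F(J,t); that is, F(J,t)^⊥ = E(J,t) (equivalently, E(J,t)^⊥ = F(J,t)). -/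
/-- `ε_j = 1` if `j ∈ J` and `0` otherwise. -/
def eps {m : ℕ} (J : Finset (Fin m)) (j : Fin m) : ℕ := if j ∈ J then 1 else 0

/-- The points `Z_J` of the `J`-affine variety. -/
def ZJ (F : Type) [Field F] [Fintype F] [DecidableEq F] {m : ℕ} (N : Fin m → ℕ)
    (J : Finset (Fin m)) : Finset (Fin m → F) :=
  Finset.univ.filter
    (fun x => ∀ j, (j ∈ J → x j ^ (N j - 1) = 1) ∧ (j ∉ J → x j ^ (N j) = x j))

/-- Evaluation of the monomial `X^b` at all the points of `Z_J`. -/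
def evm (F : Type) [Field F] [Fintype F] [DecidableEq F] {m : ℕ} (N : Fin m → ℕ)
    (J : Finset (Fin m)) (b : Fin m → ℕ) : ↥(ZJ F N J) → F :=
  fun P => ∏ j, P.1 j ^ b j

/-- The set `N(J,t)` of exponent tuples. -/
def NSet {m : ℕ} (N : Fin m → ℕ) (J : Finset (Fin m)) (t : ℕ) : Set (Fin m → ℕ) :=
  { b | (∀ j, eps J j ≤ b j ∧ b j ≤ N j - 1) ∧ ∏ j, (b j + 1 - eps J j) < t }

/-- The code `F(J,t)`: the span of the evaluations of the monomials with exponents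
in `N(J,t)`. -/
noncomputable def Fcode (F : Type) [Field F] [Fintype F] [DecidableEq F] {m : ℕ}
    (N : Fin m → ℕ) (J : Finset (Fin m)) (t : ℕ) : Submodule F (↥(ZJ F N J) → F) :=
  Submodule.span F { v | ∃ b ∈ NSet N J t, v = evm F N J b }

/-- The set `M(J,t)` of exponent tuples (those `a ∈ H_J` with `δ_a ≥ t`). -/
def MSet {m : ℕ} (N : Fin m → ℕ) (J : Finset (Fin m)) (t : ℕ) : Set (Fin m → ℕ) :=
  { a | (∀ j, a j ≤ N j - 1 - eps J j) ∧ t ≤ ∏ j, (N j - eps J j - a j) }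

/-- The code `E(J,t)`: the span of the evaluations of the monomials with exponents
in `M(J,t)`. -/
noncomputable def Ecode (F : Type) [Field F] [Fintype F] [DecidableEq F] {m : ℕ}
    (N : Fin m → ℕ) (J : Finset (Fin m)) (t : ℕ) : Submodule F (↥(ZJ F N J) → F) :=
  Submodule.span F { v | ∃ a ∈ MSet N J t, v = evm F N J a }

/-- The `j`-th coordinates of the points of `Z_J`. -/
def coordSet (F : Type) [Field F] [Fintype F] [DecidableEq F] {m : ℕ} (N : Fin m → ℕ)
    (J : Finset (Fin m)) (j : Fin m) : Finset F :=
  Finset.univ.filter (fun x => (j ∈ J → x ^ (N j - 1) = 1) ∧ (j ∉ J → x ^ (N j) = x))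

/-- The box `H_J` of exponents. -/
def expBox {m : ℕ} (N : Fin m → ℕ) (J : Finset (Fin m)) : Finset (Fin m → ℕ) :=
  Fintype.piFinset fun j => Finset.range (N j - eps J j)

section RootsOfUnity

variable {F : Type} [Field F]

lemma exists_isPrimitiveRoot_of_dvd_card_sub_one [Fintype F] {n : ℕ}
    (h : n ∣ Fintype.card F - 1) : ∃ ζ : F, IsPrimitiveRoot ζ n := by
  classical
  obtain ⟨g, hg⟩ := IsCyclic.exists_ofOrder_eq_natCard (α := Fˣ)
  have hc : Nat.card Fˣ = Fintype.card F - 1 := by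
    rw [Nat.card_eq_fintype_card, Fintype.card_units]
  have hg' : IsPrimitiveRoot g (Fintype.card F - 1) := by
    rw [← hc, ← hg]
    exact IsPrimitiveRoot.orderOf g
  have hpos : 0 < Fintype.card F - 1 := by
    have := Fintype.one_lt_card (α := F)
    omega
  obtain ⟨k, hk⟩ := h
  exact ⟨((g ^ k : Fˣ) : F),
    (IsPrimitiveRoot.coe_units_iff).2 (hg'.pow hpos (by rw [hk, mul_comm]))⟩

lemma zero_notMem_nthRootsFinset_one {n : ℕ} (hn : 0 < n) :
    (0 : F) ∉ Polynomial.nthRootsFinset n (1 : F) := by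
  rw [Polynomial.mem_nthRootsFinset hn, zero_pow hn.ne']
  exact zero_ne_one

lemma sum_pow_nthRootsFinset_eq_zero {ζ : F} {n k : ℕ} (hζ : IsPrimitiveRoot ζ n)
    (hk : 0 < k) (hkn : k < n) : ∑ x ∈ Polynomial.nthRootsFinset n (1 : F), x ^ k = 0 := by
  have hn : 0 < n := hk.trans hkn
  have hζ0 : ζ ≠ 0 := hζ.ne_zero hn.ne'
  have key : ζ ^ k * ∑ x ∈ Polynomial.nthRootsFinset n (1 : F), x ^ k =
      ∑ x ∈ Polynomial.nthRootsFinset n (1 : F), x ^ k := by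
    rw [Finset.mul_sum]
    refine Finset.sum_bij' (fun x _ => ζ * x) (fun x _ => ζ⁻¹ * x) ?_ ?_ ?_ ?_ ?_
    · intro x hx
      rw [Polynomial.mem_nthRootsFinset hn] at hx ⊢
      rw [mul_pow, hx, hζ.pow_eq_one, one_mul]
    · intro x hx
      rw [Polynomial.mem_nthRootsFinset hn] at hx ⊢
      rw [mul_pow, hx, inv_pow, hζ.pow_eq_one, inv_one, one_mul]
    · intro x _
      exact inv_mul_cancel_left₀ hζ0 x
    · intro x _
      exact mul_inv_cancel_left₀ hζ0 x
    · intro x _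
      rw [mul_pow]
  have h1 : ζ ^ k ≠ 1 := hζ.pow_ne_one_of_pos_of_lt hk.ne' hkn
  by_contra h
  exact h1 (mul_right_cancel₀ h (key.trans (one_mul _).symm))

lemma sum_pow_self_nthRootsFinset {ζ : F} {n : ℕ} (hζ : IsPrimitiveRoot ζ n) (hn : 0 < n) :
    ∑ x ∈ Polynomial.nthRootsFinset n (1 : F), x ^ n = n := by
  rw [Finset.sum_congr rfl fun x hx => (Polynomial.mem_nthRootsFinset hn _).1 hx]
  simp [hζ.card_nthRootsFinset]

end RootsOfUnity

section Coordinates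

variable {F : Type} [Field F] [Fintype F] [DecidableEq F] {m : ℕ} {N : Fin m → ℕ}
  {J : Finset (Fin m)} {j : Fin m}

lemma coordSet_of_mem (hN : 1 < N j) (hj : j ∈ J) :
    coordSet F N J j = Polynomial.nthRootsFinset (N j - 1) (1 : F) := by
  ext x
  rw [Polynomial.mem_nthRootsFinset (by omega)]
  simp [coordSet, hj]

lemma coordSet_of_notMem (hN : 1 < N j) (hj : j ∉ J) :
    coordSet F N J j = insert 0 (Polynomial.nthRootsFinset (N j - 1) (1 : F)) := by
  ext x
  rw [Finset.mem_insert, Polynomial.mem_nthRootsFinset (by omega)]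
  obtain ⟨n, hn⟩ : ∃ n, N j = n + 1 := ⟨N j - 1, by omega⟩
  simp only [coordSet, Finset.mem_filter, Finset.mem_univ, hj, true_and, false_imp_iff,
    not_false_eq_true, true_imp_iff, hn, Nat.add_sub_cancel, pow_succ]
  rcases eq_or_ne x 0 with rfl | hx
  · simp
  · rw [mul_eq_right₀ hx, or_iff_right hx]

lemma card_coordSet (hN : 1 < N j) (hdvd : N j - 1 ∣ Fintype.card F - 1) :
    (coordSet F N J j).card = N j - eps J j := by
  obtain ⟨ζ, hζ⟩ := exists_isPrimitiveRoot_of_dvd_card_sub_one hdvd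
  by_cases hj : j ∈ J
  · rw [coordSet_of_mem hN hj, hζ.card_nthRootsFinset, eps, if_pos hj]
  · rw [coordSet_of_notMem hN hj,
      Finset.card_insert_of_notMem (zero_notMem_nthRootsFinset_one (by omega)),
      hζ.card_nthRootsFinset, eps, if_neg hj]
    omega

lemma sum_coordSet_pow_eq_zero (hN : 1 < N j) (hdvd : N j - 1 ∣ Fintype.card F - 1)
    (hchar : j ∉ J → (N j : F) = 0) {k : ℕ} (hk : eps J j ≤ k) (hkN : k < N j - 1) :
    ∑ x ∈ coordSet F N J j, x ^ k = 0 := by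
  obtain ⟨ζ, hζ⟩ := exists_isPrimitiveRoot_of_dvd_card_sub_one hdvd
  rcases Nat.eq_zero_or_pos k with rfl | hk0
  · have hj : j ∉ J := fun hj => by simp [eps, hj] at hk
    simp [card_coordSet hN hdvd, eps, hj, hchar hj]
  · by_cases hj : j ∈ J
    · rw [coordSet_of_mem hN hj, sum_pow_nthRootsFinset_eq_zero hζ hk0 hkN]
    · rw [coordSet_of_notMem hN hj,
        Finset.sum_insert (zero_notMem_nthRootsFinset_one (by omega)),
        sum_pow_nthRootsFinset_eq_zero hζ hk0 hkN, zero_pow hk0.ne', add_zero]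

lemma sum_coordSet_pow_ne_zero (hN : 1 < N j) (hdvd : N j - 1 ∣ Fintype.card F - 1) :
    ∑ x ∈ coordSet F N J j, x ^ (N j - 1) ≠ 0 := by
  obtain ⟨ζ, hζ⟩ := exists_isPrimitiveRoot_of_dvd_card_sub_one hdvd
  have hn : 0 < N j - 1 := by omega
  have hsum : ∑ x ∈ coordSet F N J j, x ^ (N j - 1) = ((N j - 1 : ℕ) : F) := by
    by_cases hj : j ∈ J
    · rw [coordSet_of_mem hN hj, sum_pow_self_nthRootsFinset hζ hn]
    · rw [coordSet_of_notMem hN hj, Finset.sum_insert (zero_notMem_nthRootsFinset_one hn),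
        sum_pow_self_nthRootsFinset hζ hn, zero_pow hn.ne', zero_add]
  rw [hsum]
  have : NeZero (N j - 1) := ⟨hn.ne'⟩
  exact (hζ.neZero').out

end Coordinates

section Pairing

variable {F : Type} [Field F] [Fintype F] [DecidableEq F] {m : ℕ} {N : Fin m → ℕ}
  {J : Finset (Fin m)}

lemma ZJ_eq_piFinset : ZJ F N J = Fintype.piFinset (coordSet F N J) := by
  ext x
  simp [ZJ, coordSet]

lemma mem_expBox {a : Fin m → ℕ} : a ∈ expBox N J ↔ ∀ j, a j < N j - eps J j := by
  simp [expBox]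

lemma eps_le_one (J : Finset (Fin m)) (j : Fin m) : eps J j ≤ 1 := by
  unfold eps
  split <;> omega

lemma sum_evm_mul_evm (a b : Fin m → ℕ) :
    ∑ P, evm F N J b P * evm F N J a P =
      ∏ j, ∑ x ∈ coordSet F N J j, x ^ (b j + a j) := by
  rw [Finset.prod_univ_sum, ← ZJ_eq_piFinset, ← Finset.sum_coe_sort (ZJ F N J)]
  refine Finset.sum_congr rfl fun P _ => ?_
  simp only [evm, ← Finset.prod_mul_distrib, pow_add]

lemma sum_evm_mul_evm_eq_zero (hN : ∀ j, 1 < N j)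
    (hdvd : ∀ j, N j - 1 ∣ Fintype.card F - 1)
    (hchar : ∀ j ∉ J, (N j : F) = 0) {a b : Fin m → ℕ}
    (hb : ∀ j, eps J j ≤ b j) {j : Fin m} (hlt : b j + a j < N j - 1) :
    ∑ P, evm F N J b P * evm F N J a P = 0 := by
  rw [sum_evm_mul_evm]
  exact Finset.prod_eq_zero (Finset.mem_univ j) (sum_coordSet_pow_eq_zero (hN j) (hdvd j)
    (hchar j) ((hb j).trans (Nat.le_add_right _ _)) hlt)

lemma sum_evm_mul_evm_ne_zero (hN : ∀ j, 1 < N j)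
    (hdvd : ∀ j, N j - 1 ∣ Fintype.card F - 1)
    {a b : Fin m → ℕ} (h : ∀ j, b j + a j = N j - 1) :
    ∑ P, evm F N J b P * evm F N J a P ≠ 0 := by
  rw [sum_evm_mul_evm, Finset.prod_ne_zero_iff]
  intro j _
  rw [h j]
  exact sum_coordSet_pow_ne_zero (hN j) (hdvd j)

/-- The pairing between exponents `a` and `N - 1 - a` is triangular, hence a combination of
monomials orthogonal to the duals of an upper set of exponents has no terms in that set. -/
lemma coeff_eq_zero_of_orthogonal (hN : ∀ j, 1 < N j)
    (hdvd : ∀ j, N j - 1 ∣ Fintype.card F - 1) (hchar : ∀ j ∉ J, (N j : F) = 0)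
    (c : expBox N J → F) (S : Set (expBox N J)) (hS : IsUpperSet S)
    (horth : ∀ a ∈ S,
      ∑ P, evm F N J (fun j => N j - 1 - a.1 j) P * (∑ a', c a' • evm F N J a'.1) P = 0) :
    ∀ a ∈ S, c a = 0 := by
  intro a
  induction a using WellFoundedGT.induction with
  | ind a ih =>
    intro ha
    have hbox := mem_expBox.1 a.2
    have hsum : ∑ P, evm F N J (fun j => N j - 1 - a.1 j) P *
          (∑ a', c a' • evm F N J a'.1) P =
        ∑ a', c a' * ∑ P, evm F N J (fun j => N j - 1 - a.1 j) P * evm F N J a'.1 P := by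
      simp only [Finset.sum_apply, Pi.smul_apply, smul_eq_mul, Finset.mul_sum]
      rw [Finset.sum_comm]
      exact Finset.sum_congr rfl fun _ _ => Finset.sum_congr rfl fun _ _ => by ring
    have h0 := horth a ha
    rw [hsum, Finset.sum_eq_single a] at h0
    · refine (mul_eq_zero.1 h0).resolve_right (sum_evm_mul_evm_ne_zero hN hdvd fun j => ?_)
      have := hbox j
      omega
    · intro a' _ hne
      by_cases hle : a ≤ a'
      · rw [ih a' (lt_of_le_of_ne hle hne.symm) (hS hle ha), zero_mul]
      · obtain ⟨j, hj⟩ : ∃ j, a'.1 j < a.1 j := by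
          by_contra! hcon
          exact hle hcon
        rw [sum_evm_mul_evm_eq_zero hN hdvd hchar (j := j), mul_zero]
        · intro i
          have := hbox i
          have := eps_le_one J i
          omega
        · have := hbox j
          omega
    · simp

lemma span_range_evm_expBox (hN : ∀ j, 1 < N j)
    (hdvd : ∀ j, N j - 1 ∣ Fintype.card F - 1) (hchar : ∀ j ∉ J, (N j : F) = 0) :
    Submodule.span F (Set.range fun a : expBox N J => evm F N J a.1) = ⊤ := by
  have hli : LinearIndependent F fun a : expBox N J => evm F N J a.1 := by
    rw [Fintype.linearIndependent_iff]
    intro c hc a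
    refine coeff_eq_zero_of_orthogonal hN hdvd hchar c Set.univ isUpperSet_univ ?_ a trivial
    intro a _
    rw [hc]
    simp
  refine hli.span_eq_top_of_card_eq_finrank' ?_
  rw [Module.finrank_fintype_fun_eq_card, Fintype.card_coe, Fintype.card_coe, ZJ_eq_piFinset,
    expBox, Fintype.card_piFinset, Fintype.card_piFinset]
  exact Finset.prod_congr rfl fun j _ => by
    rw [Finset.card_range, card_coordSet (hN j) (hdvd j)]

end Pairing

/-- Proposition 8 of the paper. If `p ∣ N_j` for all `j ∉ J` then
`E(J,t)` is exactly the Euclidean dual of `F(J,t)`. -/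
theorem Ecode_eq_dual_Fcode
    (p e m : ℕ) (hp : p.Prime) (he : 0 < e)
    (F : Type) [Field F] [Fintype F] [DecidableEq F]
    (hF : Fintype.card F = p ^ e)
    (N : Fin m → ℕ) (hN : ∀ j, 1 < N j)
    (hNdvd : ∀ j, (N j - 1) ∣ (Fintype.card F - 1))
    (J : Finset (Fin m)) (hpN : ∀ j ∉ J, p ∣ N j)
    (t : ℕ) (ht : 1 ≤ t) (htn : t ≤ ∏ j, (N j - eps J j)) :
    ∀ y : ↥(ZJ F N J) → F,
      y ∈ Ecode F N J t ↔ ∀ x ∈ Fcode F N J t, ∑ i, x i * y i = 0 := by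
  have hp0 : (p : F) = 0 := by
    have h := Nat.cast_card_eq_zero F
    rw [hF, Nat.cast_pow] at h
    exact eq_zero_of_pow_eq_zero h
  have hchar : ∀ j ∉ J, (N j : F) = 0 := by
    intro j hj
    obtain ⟨k, hk⟩ := hpN j hj
    rw [hk, Nat.cast_mul, hp0, zero_mul]
  intro y
  constructor
  · intro hy x hx
    induction hx using Submodule.span_induction with
    | zero => simp
    | add u v _ _ hu hv =>
      simp only [Pi.add_apply, add_mul, Finset.sum_add_distrib, hu, hv, add_zero]
    | smul r u _ hu =>
      simp only [Pi.smul_apply, smul_eq_mul, mul_assoc, ← Finset.mul_sum, hu, mul_zero]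
    | mem u hu =>
      obtain ⟨b, ⟨hb, hbt⟩, rfl⟩ := hu
      induction hy using Submodule.span_induction with
      | zero => simp
      | add u v _ _ hu hv =>
        simp only [Pi.add_apply, mul_add, Finset.sum_add_distrib, hu, hv, add_zero]
      | smul r u _ hu =>
        simp only [Pi.smul_apply, smul_eq_mul, mul_left_comm _ r, ← Finset.mul_sum, hu, mul_zero]
      | mem u hu =>
        obtain ⟨a, ⟨ha, hat⟩, rfl⟩ := hu
        obtain ⟨j, hj⟩ : ∃ j, b j + a j < N j - 1 := by
          by_contra! hcon
          refine (hbt.trans_le hat).not_ge (Finset.prod_le_prod' fun j _ => ?_)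
          have := hcon j
          have := hb j
          omega
        exact sum_evm_mul_evm_eq_zero hN hNdvd hchar (fun j => (hb j).1) hj
  · intro h
    have hy : y ∈ Submodule.span F (Set.range fun a : expBox N J => evm F N J a.1) := by
      rw [span_range_evm_expBox hN hNdvd hchar]
      trivial
    obtain ⟨c, rfl⟩ := (Submodule.mem_span_range_iff_exists_fun F).1 hy
    have hc := coeff_eq_zero_of_orthogonal hN hNdvd hchar c
      {a | ∏ j, (N j - eps J j - a.1 j) < t}
      (fun a a' hle ha => lt_of_le_of_lt
        (Finset.prod_le_prod' fun j _ => Nat.sub_le_sub_left (hle j) _) ha)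
      (fun a ha => h _ (Submodule.subset_span ⟨_, ⟨fun j => ?_, ?_⟩, rfl⟩))
    · refine Submodule.sum_mem _ fun a _ => ?_
      by_cases hat : ∏ j, (N j - eps J j - a.1 j) < t
      · rw [hc a hat, zero_smul]
        exact Submodule.zero_mem _
      · refine Submodule.smul_mem _ _
          (Submodule.subset_span ⟨a.1, ⟨fun j => ?_, not_lt.1 hat⟩, rfl⟩)
        have := mem_expBox.1 a.2 j
        omega
    · have := mem_expBox.1 a.2 j
      have := eps_le_one J j
      omega
    · refine lt_of_le_of_lt (Finset.prod_le_prod' fun j _ => ?_) ha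
      have := mem_expBox.1 a.2 j
      omega
end
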